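/- Let f ∈ ℂ{x,y} (n = 2) be reduced and suppose {δ₁, δ₂} is a basis of the free module Der(log f) with coefficient matrix of determinant u·f, u a unit. Then the principal symbols σ(δ₁), σ(δ₂), which are linear forms in ξ₁, ξ₂ with coefficients in ℂ{x,y}, form a regular sequence in ℂ{x,y}[ξ₁,ξ₂]. -/

import Mathlib

open MvPolynomial

/-- Formal power series in one variable, indexed by `Fin 1`, form a principal ideal ring. -/
theorem MvPowerSeries.isPrincipalIdealRing_fin_one (k : Type*) [Field k] :
    IsPrincipalIdealRing (MvPowerSeries (Fin 1) k) :=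
  let e : PowerSeries k ≃ₐ[k] MvPowerSeries (Fin 1) k :=
    MvPowerSeries.renameEquiv k (Equiv.ofUnique Unit (Fin 1))
  IsPrincipalIdealRing.of_surjective e e.surjective

/-- Formal power series in two variables over a field form a unique factorization domain. -/
theorem MvPowerSeries.uniqueFactorizationMonoid_fin_two (k : Type*) [Field k] :
    UniqueFactorizationMonoid (MvPowerSeries (Fin 2) k) :=
  have := MvPowerSeries.isPrincipalIdealRing_fin_one k
  have : IsDomain (MvPowerSeries (Fin 1) k) := NoZeroDivisors.to_isDomain _
  (MvPowerSeries.finSuccEquiv k 1).symm.toMulEquiv.uniqueFactorizationMonoid inferInstance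

/-- A prime of `R[ξ₁, ξ₂]` dividing `d ξ₁` and `d ξ₂` divides `d`. -/
theorem MvPolynomial.dvd_C_of_prime_of_dvd_C_mul_X {R : Type*} [CommRing R] [IsDomain R]
    {q : MvPolynomial (Fin 2) R} (hq : Prime q) {d : R}
    (h0 : q ∣ C d * X 0) (h1 : q ∣ C d * X 1) : q ∣ C d := by
  by_contra hd
  have hX0 := (hq.dvd_or_dvd h0).resolve_left hd
  have hX1 := (hq.dvd_or_dvd h1).resolve_left hd
  have h : (X 0 : MvPolynomial (Fin 2) R) ∣ X 1 :=
    (hq.associated_of_dvd X_prime hX0).symm.dvd.trans hX1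
  exact absurd (X_dvd_X.1 h) (by decide)

theorem MvPolynomial.coeff_single_linear {R : Type*} [CommRing R]
    (a : Matrix (Fin 2) (Fin 2) R) (i j : Fin 2) :
    (C (a i 0) * X (0 : Fin 2) + C (a i 1) * X 1 :
      MvPolynomial (Fin 2) R).coeff (Finsupp.single j 1) = a i j := by
  fin_cases j <;> simp [coeff_C_mul, coeff_X, Finsupp.single_left_inj]

theorem MvPolynomial.linear_ne_zero_of_det_ne_zero {R : Type*} [CommRing R]
    (a : Matrix (Fin 2) (Fin 2) R) (h0 : a.det ≠ 0) :
    (C (a 0 0) * X (0 : Fin 2) + C (a 0 1) * X 1 : MvPolynomial (Fin 2) R) ≠ 0 := by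
  intro h
  have hrow (j : Fin 2) : a 0 j = 0 := by rw [← coeff_single_linear a 0 j, h, coeff_zero]
  exact h0 (Matrix.det_eq_zero_of_row_eq_zero 0 hrow)

/-- Over a unique factorization domain, two linear forms in two variables whose coefficient matrix
has nonzero squarefree determinant are relatively prime. -/
theorem MvPolynomial.isRelPrime_linear_of_squarefree_det {R : Type*} [CommRing R] [IsDomain R]
    [UniqueFactorizationMonoid R] (a : Matrix (Fin 2) (Fin 2) R) (h0 : a.det ≠ 0)
    (hsq : Squarefree a.det) :
    IsRelPrime (C (a 0 0) * X (0 : Fin 2) + C (a 0 1) * X 1)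
      (C (a 1 0) * X (0 : Fin 2) + C (a 1 1) * X 1) := by
  have hc := coeff_single_linear a
  refine (UniqueFactorizationMonoid.isRelPrime_iff_no_prime_factors
    (linear_ne_zero_of_det_ne_zero a h0)).2 ?_
  rw [Matrix.det_fin_two] at h0 hsq
  intro q hq₁ hq₂ hq
  have hqd : q ∣ C (a 0 0 * a 1 1 - a 0 1 * a 1 0) := by
    refine dvd_C_of_prime_of_dvd_C_mul_X hq ?_ ?_
    · convert (hq₁.mul_left (C (a 1 1))).sub (hq₂.mul_left (C (a 0 1))) using 1
      simp only [C_sub, C_mul]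
      ring
    · convert (hq₂.mul_left (C (a 0 0))).sub (hq₁.mul_left (C (a 1 0))) using 1
      simp only [C_sub, C_mul]
      ring
  obtain ⟨r, -, rfl⟩ := (dvd_C_iff_exists h0).1 hqd
  rw [C_dvd_iff_dvd_coeff] at hq₁ hq₂
  have hr0 (j : Fin 2) : r ∣ a 0 j := hc 0 j ▸ hq₁ _
  have hr1 (j : Fin 2) : r ∣ a 1 j := hc 1 j ▸ hq₂ _
  exact hq.not_isUnit <| (hsq r <|
    (mul_dvd_mul (hr0 0) (hr1 1)).sub (mul_dvd_mul (hr0 1) (hr1 0))).map C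

/-- Two relatively prime elements of a domain with the decomposition property, the first of them
nonzero, form a regular sequence as soon as they generate a proper ideal. -/
theorem IsRelPrime.isRegular_pair {S : Type*} [CommRing S] [IsDomain S] [DecompositionMonoid S]
    {s t : S} (hs : s ≠ 0) (hst : IsRelPrime s t) (hproper : Ideal.span {s, t} ≠ ⊤) :
    RingTheory.Sequence.IsRegular S [s, t] := by
  refine ⟨⟨fun i hi ↦ ?_⟩, ?_⟩
  · rw [isSMulRegular_quotient_iff_mem_of_smul_mem]
    match i, hi with
    | 0, _ => simp [hs]
    | 1, _ =>
      intro x hx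
      simp only [List.take_succ_cons, List.take_zero, Ideal.ofList_singleton, smul_eq_mul,
        Ideal.mul_top, List.getElem_cons_succ, List.getElem_cons_zero,
        Ideal.mem_span_singleton] at hx ⊢
      exact hst.dvd_of_dvd_mul_left hx
  · simpa [Ideal.span_insert, eq_comm] using hproper

/-- Dimension 2 case: let `f ∈ ℂ⟦x,y⟧` be reduced (squarefree) and suppose `δ₁ = a₁∂₁ + b₁∂₂`,
`δ₂ = a₂∂₁ + b₂∂₂` form a basis of `Der(log f)`, i.e. (by Saito's criterion) the determinant
`a₁b₂ - a₂b₁` of the coefficient matrix equals `u * f` with `u` a unit.  Then the principal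
symbols `σ(δᵢ) = aᵢξ₁ + bᵢξ₂`, linear forms in `ξ₁, ξ₂`, form a regular sequence in
`ℂ⟦x,y⟧[ξ₁,ξ₂]`. -/
theorem symbols_regular_sequence_dim_two
    (f : MvPowerSeries (Fin 2) ℂ)
    (hred : ∀ g : MvPowerSeries (Fin 2) ℂ, g * g ∣ f → IsUnit g)
    (a : Matrix (Fin 2) (Fin 2) (MvPowerSeries (Fin 2) ℂ))
    (u : MvPowerSeries (Fin 2) ℂ) (hu : IsUnit u)
    (hdet : a 0 0 * a 1 1 - a 0 1 * a 1 0 = u * f) :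
    RingTheory.Sequence.IsRegular (MvPolynomial (Fin 2) (MvPowerSeries (Fin 2) ℂ))
      [C (a 0 0) * X (0 : Fin 2) + C (a 0 1) * X 1, C (a 1 0) * X (0 : Fin 2) + C (a 1 1) * X 1] := by
  have := MvPowerSeries.uniqueFactorizationMonoid_fin_two ℂ
  have : IsDomain (MvPowerSeries (Fin 2) ℂ) := NoZeroDivisors.to_isDomain _
  have hf : f ≠ 0 := by
    rintro rfl
    exact not_isUnit_zero (hred 0 (by simp))
  have hdet' : a.det = u * f := by rw [Matrix.det_fin_two, hdet]
  have h0 : a.det ≠ 0 := hdet' ▸ mul_ne_zero hu.ne_zero hf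
  have hsq : Squarefree a.det := fun g hg ↦ hred g (hu.dvd_mul_left.1 (hdet' ▸ hg))
  refine (isRelPrime_linear_of_squarefree_det a h0 hsq).isRegular_pair
    (linear_ne_zero_of_det_ne_zero a h0) ?_
  intro h
  have hle : Ideal.span {C (a 0 0) * X (0 : Fin 2) + C (a 0 1) * X 1,
      C (a 1 0) * X (0 : Fin 2) + C (a 1 1) * X 1} ≤ RingHom.ker constantCoeff := by
    simp [Ideal.span_le, Set.insert_subset_iff, RingHom.mem_ker]
  exact RingHom.ker_ne_top _ (top_le_iff.1 (h ▸ hle))
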